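/- arXiv:1403.1195 — 2 statements merged into one kernel-verified Lean document; each statement's English description precedes it below -/
import Mathlib

section
/- Let G be a group with a finite symmetric generating set S (e ∉ S) and let P be the lazy simple random walk measure. Suppose there are constants K, L > 0 and ν ∈ (0,1] such that |B_n| ≤ L·exp(K·n^ν) for all n ≥ 1, where B_n is the ball of radius n. Then there is a constant K' > 0 such that E|P^{(n)}| ≤ K'·n^{1/(2−ν)} for all n ≥ 1. -/
open scoped Classical

noncomputable section

/-- Word length of `g` with respect to the generating set `S`
(least `n` such that `g` is a product of `n` elements of `S`). -/
def wordLength {G : Type*} [Group G] (S : Set G) (g : G) : ℕ :=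
  sInf {n | ∃ l : List G, (∀ x ∈ l, x ∈ S) ∧ l.length = n ∧ l.prod = g}

/-- The ball of radius `n` with respect to the generating set `S`. -/
def ball {G : Type*} [Group G] (S : Set G) (n : ℕ) : Set G :=
  {g | wordLength S g ≤ n}

/-- The lazy simple random walk measure `P = (1/2)(δ_e + U_S)`. -/
def lazyWalk {G : Type*} [Group G] (S : Finset G) : G → ℝ := fun g =>
  (if g = 1 then (1 : ℝ) / 2 else 0) + (if g ∈ S then 1 / (2 * (S.card : ℝ)) else 0)

/-- The `n`-fold convolution power of a measure `P` (with `P^{(0)} = δ_e`). -/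
def convPow {G : Type*} [Group G] (P : G → ℝ) : ℕ → G → ℝ
  | 0 => fun g => if g = 1 then 1 else 0
  | n + 1 => fun g => ∑' h : G, convPow P n h * P (h⁻¹ * g)

/-- The speed (expected word length) of the walk at time `n`. -/
def speed {G : Type*} [Group G] (S : Set G) (P : G → ℝ) (n : ℕ) : ℝ :=
  ∑' g : G, convPow P n g * (wordLength S g : ℝ)

/-- The entropy of a measure `Q`, with the convention `0 · ln 0 = 0`. -/
def entropy {G : Type*} [Group G] (Q : G → ℝ) : ℝ :=
  -∑' g : G, Q g * Real.log (Q g)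

/-- A real Hilbert space equipped with an isometric linear `G`-representation and
a cocycle for it: `b (x y) = λ(x) b(y) + b(x)`. -/
structure HilbertCocycle (G : Type*) [Group G] where
  space : Type
  [nacg : NormedAddCommGroup space]
  [ips : InnerProductSpace ℝ space]
  [complete : CompleteSpace space]
  rep : G →* (space ≃ₗᵢ[ℝ] space)
  cocycle : G → space
  cocycle_rel : ∀ x y : G, cocycle (x * y) = rep x (cocycle y) + cocycle x

attribute [instance] HilbertCocycle.nacg HilbertCocycle.ips HilbertCocycle.complete

/-- The set of values at `x` of concave functions on `[0,∞)` dominating `f` on `ℕ`. -/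
def concaveMajorants (f : ℕ → ℝ) (x : ℝ) : Set ℝ :=
  {y | ∃ h : ℝ → ℝ, ConcaveOn ℝ (Set.Ici 0) h ∧ (∀ k : ℕ, f k ≤ h k) ∧ y = h x}

/-- The concave hull of `f : ℕ → ℝ`: the pointwise infimum of concave majorants. -/
def concaveHull (f : ℕ → ℝ) (x : ℝ) : ℝ := sInf (concaveMajorants f x)

/-- The log-volume of the ball of radius `n`. -/
def growthLog {G : Type*} [Group G] (S : Set G) (n : ℕ) : ℝ :=
  Real.log (Nat.card ↥(ball S n))

end

section WordLength

variable {G : Type*} [Group G]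

lemma exists_list_prod_eq {S : Set G} (hsym : ∀ s ∈ S, s⁻¹ ∈ S)
    (hgen : Subgroup.closure S = ⊤) (g : G) :
    ∃ l : List G, (∀ x ∈ l, x ∈ S) ∧ l.prod = g := by
  have hinv : S ∪ S⁻¹ = S := Set.union_eq_self_of_subset_right fun x hx => by
    simpa using hsym _ hx
  have hg : g ∈ (Subgroup.closure S).toSubmonoid := by simp [hgen]
  rw [Subgroup.closure_toSubmonoid, hinv] at hg
  exact Submonoid.exists_list_of_mem_closure hg

lemma exists_list_length_eq_wordLength {S : Set G} (hsym : ∀ s ∈ S, s⁻¹ ∈ S)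
    (hgen : Subgroup.closure S = ⊤) (g : G) :
    ∃ l : List G, (∀ x ∈ l, x ∈ S) ∧ l.length = wordLength S g ∧ l.prod = g := by
  obtain ⟨l, hl, hg⟩ := exists_list_prod_eq hsym hgen g
  exact Nat.sInf_mem (s := {n | ∃ l : List G, (∀ x ∈ l, x ∈ S) ∧ l.length = n ∧ l.prod = g})
    ⟨l.length, l, hl, rfl, hg⟩

lemma wordLength_prod_le {S : Set G} {l : List G} (hl : ∀ x ∈ l, x ∈ S) :
    wordLength S l.prod ≤ l.length :=
  Nat.sInf_le ⟨l, hl, rfl, rfl⟩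

lemma wordLength_one (S : Set G) : wordLength S 1 = 0 := by
  simpa using wordLength_prod_le (S := S) (l := []) (by simp)

lemma wordLength_le_one {S : Set G} {s : G} (hs : s ∈ S) : wordLength S s ≤ 1 := by
  simpa using wordLength_prod_le (S := S) (l := [s]) (by simpa using hs)

lemma wordLength_mul_le {S : Set G} (hsym : ∀ s ∈ S, s⁻¹ ∈ S)
    (hgen : Subgroup.closure S = ⊤) (g h : G) :
    wordLength S (g * h) ≤ wordLength S g + wordLength S h := by
  obtain ⟨l, hl, hlen, rfl⟩ := exists_list_length_eq_wordLength hsym hgen g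
  obtain ⟨m, hm, hmlen, rfl⟩ := exists_list_length_eq_wordLength hsym hgen h
  rw [← hlen, ← hmlen, ← List.prod_append, ← List.length_append]
  refine wordLength_prod_le fun x hx => ?_
  rcases List.mem_append.1 hx with h | h
  exacts [hl x h, hm x h]

lemma finite_ball {S : Finset G} (hsym : ∀ s ∈ S, s⁻¹ ∈ S)
    (hgen : Subgroup.closure (S : Set G) = ⊤) (n : ℕ) : (ball (S : Set G) n).Finite := by
  have hfin : {l : List S | l.length ≤ n}.Finite := List.finite_length_le S n
  refine (hfin.image fun l => (l.map Subtype.val).prod).subset fun g hg => ?_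
  obtain ⟨l, hl, hlen, rfl⟩ :=
    exists_list_length_eq_wordLength (S := (S : Set G)) (by simpa using hsym) hgen g
  lift l to List S using fun x hx => by simpa using hl x hx
  refine ⟨l, ?_, rfl⟩
  have : wordLength (S : Set G) (l.map Subtype.val).prod ≤ n := hg
  rw [← hlen] at this
  simpa using this

end WordLength

namespace MonoidAlgebra

variable {G : Type*}

/-- The squared `ℓ²` norm of the coefficients. -/
noncomputable def sqNorm (f : MonoidAlgebra ℝ G) : ℝ := ∑' g, f.coeff g ^ 2

lemma summable_sq_coeff (f : MonoidAlgebra ℝ G) : Summable fun g => f.coeff g ^ 2 :=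
  summable_of_ne_finset_zero (s := f.coeff.support) fun g hg => by
    simp [Finsupp.notMem_support_iff.1 hg]

lemma coeff_sq_le_sqNorm (f : MonoidAlgebra ℝ G) (g : G) : f.coeff g ^ 2 ≤ sqNorm f :=
  (summable_sq_coeff f).le_tsum g fun _ _ => sq_nonneg _

variable [Group G]

lemma coeff_mul_eq_tsum (f g : MonoidAlgebra ℝ G) (x : G) :
    (f * g).coeff x = ∑' a, f.coeff a * g.coeff (a⁻¹ * x) := by
  rw [coeff_mul_apply_left, Finsupp.sum, tsum_eq_sum]
  intro a ha
  simp [Finsupp.notMem_support_iff.1 ha]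

/-- Invariance of the coefficients under inversion. -/
def IsSymm (f : MonoidAlgebra ℝ G) : Prop := ∀ x, f.coeff x⁻¹ = f.coeff x

lemma IsSymm.coeff_mul_inv {f g : MonoidAlgebra ℝ G} (hf : IsSymm f) (hg : IsSymm g) (x : G) :
    (f * g).coeff x⁻¹ = (g * f).coeff x := by
  rw [coeff_mul_eq_tsum, coeff_mul_eq_tsum, ← (Equiv.mulLeft x).tsum_eq fun b => g.coeff b * f.coeff (b⁻¹ * x)]
  refine tsum_congr fun a => ?_
  have h : (a⁻¹ * x⁻¹ : G) = (x * a)⁻¹ := by group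
  have h' : ((x * a)⁻¹ * x : G) = a⁻¹ := by group
  rw [Equiv.coe_mulLeft]
  beta_reduce
  rw [h, h', hg, hf, mul_comm]

lemma IsSymm.mul {f g : MonoidAlgebra ℝ G} (hf : IsSymm f) (hg : IsSymm g)
    (hfg : Commute f g) : IsSymm (f * g) := fun x => by
  rw [hf.coeff_mul_inv hg, hfg.eq]

lemma isSymm_one : IsSymm (1 : MonoidAlgebra ℝ G) := fun x => by
  simp [one_def, Finsupp.single_apply, eq_comm (a := (1 : G))]

lemma IsSymm.pow {f : MonoidAlgebra ℝ G} (hf : IsSymm f) (n : ℕ) : IsSymm (f ^ n) := by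
  induction n with
  | zero => simpa using isSymm_one
  | succ n ih =>
    rw [pow_succ]
    exact ih.mul hf ((Commute.refl f).pow_left n)

lemma coeff_aeval (f : MonoidAlgebra ℝ G) (q : Polynomial ℝ) (x : G) :
    (Polynomial.aeval f q).coeff x =
      ∑ i ∈ Finset.range (q.natDegree + 1), q.coeff i * (f ^ i).coeff x := by
  rw [Polynomial.aeval_eq_sum_range, coeff_sum, Finsupp.finsetSum_apply]
  rfl

lemma IsSymm.aeval {f : MonoidAlgebra ℝ G} (hf : IsSymm f) (q : Polynomial ℝ) :
    IsSymm (Polynomial.aeval f q) := fun x => by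
  rw [coeff_aeval, coeff_aeval]
  exact Finset.sum_congr rfl fun i _ => by rw [hf.pow i x]

lemma IsSymm.coeff_mul_self_one {f : MonoidAlgebra ℝ G} (hf : IsSymm f) :
    (f * f).coeff 1 = sqNorm f := by
  rw [coeff_mul_eq_tsum, sqNorm]
  exact tsum_congr fun a => by rw [mul_one, hf, sq]

lemma sqNorm_mul_le {p : MonoidAlgebra ℝ G} (hp : ∀ x, 0 ≤ p.coeff x)
    (hsum : p.coeff.sum (fun _ r => r) ≤ 1) (f : MonoidAlgebra ℝ G) :
    sqNorm (p * f) ≤ sqNorm f := by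
  have hsh (a : G) : Summable fun x => p.coeff a * f.coeff (a⁻¹ * x) ^ 2 :=
    (((Equiv.mulLeft a⁻¹).summable_iff).2 (summable_sq_coeff f)).mul_left _
  have hf : 0 ≤ sqNorm f := tsum_nonneg fun _ => sq_nonneg _
  calc sqNorm (p * f) ≤ ∑' x, ∑ a ∈ p.coeff.support, p.coeff a * f.coeff (a⁻¹ * x) ^ 2 := by
        refine (summable_sq_coeff _).tsum_le_tsum (fun x => ?_) (summable_sum fun a _ => hsh a)
        rw [coeff_mul_apply_left, Finsupp.sum]
        refine (Finset.sum_sq_le_sum_mul_sum_of_sq_le_mul p.coeff.support (f := p.coeff)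
          (g := fun a => p.coeff a * f.coeff (a⁻¹ * x) ^ 2)
          (fun a _ => hp a) (fun a _ => mul_nonneg (hp a) (sq_nonneg _))
          (fun a _ => le_of_eq (by ring))).trans ?_
        exact mul_le_of_le_one_left
          (Finset.sum_nonneg fun a _ => mul_nonneg (hp a) (sq_nonneg _)) hsum
    _ = ∑ a ∈ p.coeff.support, p.coeff a * sqNorm f := by
        rw [Summable.tsum_finsetSum fun a _ => hsh a]
        refine Finset.sum_congr rfl fun a _ => ?_
        rw [tsum_mul_left, sqNorm, ← (Equiv.mulLeft a⁻¹).tsum_eq fun g => f.coeff g ^ 2]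
        rfl
    _ ≤ sqNorm f := by
        rw [← Finset.sum_mul]
        exact mul_le_of_le_one_left hf hsum

end MonoidAlgebra

section Chebyshev

open Polynomial Polynomial.Chebyshev

lemma Polynomial.Chebyshev.U_sq_add_U_sq (n : ℤ) :
    U ℝ n ^ 2 + U ℝ (n + 1) ^ 2 - 2 * X * U ℝ n * U ℝ (n + 1) = 1 := by
  induction n with
  | zero => simp; ring
  | succ n ih =>
    have h₁ := U_add_two ℝ n
    linear_combination (norm := ring_nf) (U ℝ (2 + n) - U ℝ n) * h₁ + ih
  | pred n ih =>
    have h₁ := U_sub_one ℝ (-n)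
    linear_combination (norm := ring_nf) (U ℝ (-1 - n) - U ℝ (1 - n)) * h₁ + ih

lemma Polynomial.Chebyshev.T_sq_add (n : ℤ) :
    T ℝ n * T ℝ n + U ℝ (n - 1) * U ℝ (n - 1) - (X * U ℝ (n - 1)) * (X * U ℝ (n - 1)) = 1 := by
  have h := U_sq_add_U_sq (n - 1)
  rw [sub_add_cancel] at h
  rw [T_eq_U_sub_X_mul_U]
  linear_combination h

variable {G : Type*} [Group G]

open MonoidAlgebra in
lemma abs_coeff_aeval_chebyshev_le_one {p : MonoidAlgebra ℝ G} (hsymm : IsSymm p)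
    (hp : ∀ x, 0 ≤ p.coeff x) (hsum : p.coeff.sum (fun _ r => r) ≤ 1) (k : ℤ) (g : G) :
    |(aeval p (T ℝ k)).coeff g| ≤ 1 := by
  have h := congrArg (fun q => (aeval p q).coeff 1) (T_sq_add k)
  have hX : IsSymm (p * aeval p (U ℝ (k - 1))) := by
    have := hsymm.aeval (X * U ℝ (k - 1))
    rwa [map_mul, aeval_X] at this
  simp only [map_sub, map_add, map_mul, map_one, aeval_X, MonoidAlgebra.coeff_sub, MonoidAlgebra.coeff_add,
    Finsupp.sub_apply, Finsupp.add_apply, (hsymm.aeval _).coeff_mul_self_one,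
    hX.coeff_mul_self_one, coeff_one_one] at h
  have h1 := sqNorm_mul_le hp hsum (aeval p (U ℝ (k - 1)))
  have h2 := coeff_sq_le_sqNorm (aeval p (T ℝ k)) g
  exact abs_le_one_iff_mul_self_le_one.2 (by nlinarith)

/-- Propagating a bound on the coefficients of `T_k(p)` to those of `p ^ n T_k(p)` through the
three-term recurrence. -/
lemma abs_coeff_pow_mul_chebyshev_le {p : MonoidAlgebra ℝ G} {g : G} {C r : ℝ}
    (h : ∀ k : ℤ, |(aeval p (T ℝ k)).coeff g| ≤ C * Real.cosh (r * k)) (n : ℕ) (k : ℤ) :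
    |(aeval p (X ^ n * T ℝ k)).coeff g| ≤ C * Real.cosh r ^ n * Real.cosh (r * k) := by
  induction n generalizing k with
  | zero => simpa using h k
  | succ n ih =>
    have hrec : X ^ (n + 1) * T ℝ k =
        Polynomial.C (1 / 2 : ℝ) * (X ^ n * T ℝ (k + 1) + X ^ n * T ℝ (k - 1)) := by
      have h2 : Polynomial.C (1 / 2 : ℝ) * 2 = 1 := by
        rw [show (2 : ℝ[X]) = Polynomial.C 2 from rfl, ← Polynomial.C_mul]
        norm_num
      rw [T_add_one]
      linear_combination (-X ^ (n + 1) * T ℝ k) * h2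
    have hco : (aeval p (X ^ (n + 1) * T ℝ k)).coeff g =
        1 / 2 * ((aeval p (X ^ n * T ℝ (k + 1))).coeff g +
          (aeval p (X ^ n * T ℝ (k - 1))).coeff g) := by
      rw [hrec, ← smul_eq_C_mul, map_smul, map_add]
      rfl
    have h1 := ih (k + 1)
    have h2 := ih (k - 1)
    have hc : Real.cosh (r * (k + 1 : ℤ)) + Real.cosh (r * (k - 1 : ℤ)) =
        2 * (Real.cosh r * Real.cosh (r * k)) := by
      push_cast
      rw [mul_add, mul_sub, mul_one, Real.cosh_add, Real.cosh_sub]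
      ring
    rw [hco, abs_mul, abs_of_pos (by norm_num : (0 : ℝ) < 1 / 2)]
    have h3 := abs_add_le ((aeval p (X ^ n * T ℝ (k + 1))).coeff g)
      ((aeval p (X ^ n * T ℝ (k - 1))).coeff g)
    calc _ ≤ 1 / 2 * (C * Real.cosh r ^ n *
          (Real.cosh (r * (k + 1 : ℤ)) + Real.cosh (r * (k - 1 : ℤ)))) := by linarith
      _ = _ := by rw [hc]; ring

lemma coeff_pow_eq_zero {S : Set G} (hsym : ∀ s ∈ S, s⁻¹ ∈ S) (hgen : Subgroup.closure S = ⊤)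
    {p : MonoidAlgebra ℝ G} (hp : ∀ x, 1 < wordLength S x → p.coeff x = 0) (n : ℕ) {x : G}
    (hx : n < wordLength S x) : (p ^ n).coeff x = 0 := by
  induction n generalizing x with
  | zero =>
    have : 1 ≠ x := by
      rintro rfl
      simp [wordLength_one] at hx
    simp [MonoidAlgebra.one_def, this]
  | succ n ih =>
    rw [pow_succ, MonoidAlgebra.coeff_mul_eq_tsum]
    convert tsum_zero with a
    by_cases ha : n < wordLength S a
    · rw [ih ha, zero_mul]
    · have h := wordLength_mul_le hsym hgen a (a⁻¹ * x)
      rw [mul_inv_cancel_left] at h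
      rw [hp _ (by omega), mul_zero]

/-- The Varopoulos–Carne bound for symmetric nearest-neighbour walks on groups. -/
lemma coeff_pow_le_exp {S : Set G} (hsym : ∀ s ∈ S, s⁻¹ ∈ S) (hgen : Subgroup.closure S = ⊤)
    {p : MonoidAlgebra ℝ G} (hlen : ∀ x, 1 < wordLength S x → p.coeff x = 0)
    (hsymm : MonoidAlgebra.IsSymm p) (hp : ∀ x, 0 ≤ p.coeff x)
    (hsum : p.coeff.sum (fun _ r => r) ≤ 1) {n : ℕ} (hn : 1 ≤ n) (g : G) :
    (p ^ n).coeff g ≤ 2 * Real.exp (-((wordLength S g : ℝ) ^ 2 / (2 * n))) := by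
  obtain ⟨d, hd⟩ : ∃ d : ℝ, d = wordLength S g := ⟨_, rfl⟩
  rw [← hd]
  have hn0 : (0 : ℝ) < n := by exact_mod_cast hn
  set r : ℝ := d / n with hr
  have hr0 : 0 ≤ r := by rw [hr, hd]; positivity
  have hT (k : ℤ) : |(aeval p (T ℝ k)).coeff g| ≤ 2 * Real.exp (-(r * d)) * Real.cosh (r * k) := by
    by_cases hk : k.natAbs < wordLength S g
    · have h0 : (aeval p (T ℝ k)).coeff g = 0 := by
        rw [MonoidAlgebra.coeff_aeval]
        refine Finset.sum_eq_zero fun i hi => ?_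
        rw [natDegree_T, Finset.mem_range] at hi
        rw [coeff_pow_eq_zero hsym hgen hlen i (by omega), mul_zero]
      rw [h0, abs_zero]
      positivity
    · refine (abs_coeff_aeval_chebyshev_le_one hsymm hp hsum k g).trans ?_
      have hdk : d ≤ |(k : ℝ)| := by
        rw [hd, ← Int.cast_abs, Int.abs_eq_natAbs]
        exact_mod_cast not_lt.1 hk
      have hcosh : Real.exp (r * d) ≤ 2 * Real.cosh (r * k) := by
        rw [← Real.cosh_abs, abs_mul, abs_of_nonneg hr0, Real.cosh_eq]
        have h1 : Real.exp (r * d) ≤ Real.exp (r * |(k : ℝ)|) := by gcongr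
        have h2 := Real.exp_pos (-(r * |(k : ℝ)|))
        linarith
      calc (1 : ℝ) = Real.exp (-(r * d)) * Real.exp (r * d) := by rw [← Real.exp_add]; simp
        _ ≤ Real.exp (-(r * d)) * (2 * Real.cosh (r * k)) := by gcongr
        _ = _ := by ring
  have h := (le_abs_self _).trans (abs_coeff_pow_mul_chebyshev_le hT n 0)
  simp only [T_zero, mul_one, map_pow, aeval_X, Int.cast_zero, mul_zero, Real.cosh_zero] at h
  refine h.trans ?_
  calc 2 * Real.exp (-(r * d)) * Real.cosh r ^ n
      ≤ 2 * Real.exp (-(r * d)) * Real.exp (r ^ 2 / 2) ^ n := by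
        gcongr
        exact Real.cosh_le_exp_half_sq r
    _ = 2 * Real.exp (-(d ^ 2 / (2 * n))) := by
        rw [← Real.exp_nat_mul, mul_assoc, ← Real.exp_add]
        congr 2
        rw [hr]
        field_simp
        ring

end Chebyshev

section LazyWalk

variable {G : Type*} [Group G]

lemma lazyWalk_eq_zero {S : Finset G} {g : G} (hg : g ∉ insert 1 S) : lazyWalk S g = 0 := by
  simp only [Finset.mem_insert, not_or] at hg
  simp [lazyWalk, hg.1, hg.2]

lemma lazyWalk_nonneg (S : Finset G) (g : G) : 0 ≤ lazyWalk S g := by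
  unfold lazyWalk
  positivity

/-- The lazy walk measure as an element of the group algebra. -/
noncomputable def lazyWalkAlg (S : Finset G) : MonoidAlgebra ℝ G :=
  .ofCoeff (Finsupp.onFinset (insert 1 S) (lazyWalk S) fun _ h =>
    by_contra fun h' => h (lazyWalk_eq_zero h'))

lemma coeff_lazyWalkAlg (S : Finset G) (g : G) : (lazyWalkAlg S).coeff g = lazyWalk S g := rfl

lemma sum_coeff_lazyWalkAlg {S : Finset G} (hS1 : (1 : G) ∉ S) (hSne : S.Nonempty) :
    (lazyWalkAlg S).coeff.sum (fun _ r => r) = 1 := by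
  rw [lazyWalkAlg, MonoidAlgebra.coeff_ofCoeff, Finsupp.onFinset_sum _ fun _ => rfl,
    Finset.sum_insert hS1]
  have hcard : (S.card : ℝ) ≠ 0 := by exact_mod_cast hSne.card_pos.ne'
  have h : ∑ g ∈ S, lazyWalk S g = ∑ g ∈ S, 1 / (2 * (S.card : ℝ)) :=
    Finset.sum_congr rfl fun g hg => by
      have : g ≠ 1 := fun h => hS1 (h ▸ hg)
      simp [lazyWalk, hg, this]
  rw [h, Finset.sum_const, nsmul_eq_mul]
  simp only [lazyWalk, if_true, if_neg hS1]
  field_simp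
  norm_num

lemma isSymm_lazyWalkAlg {S : Finset G} (hsym : ∀ s ∈ S, s⁻¹ ∈ S) :
    (lazyWalkAlg S).IsSymm := fun x => by
  have h : x⁻¹ ∈ S ↔ x ∈ S := ⟨fun h => by simpa using hsym _ h, hsym x⟩
  simp only [coeff_lazyWalkAlg, lazyWalk, inv_eq_one, h]

lemma convPow_lazyWalk (S : Finset G) (n : ℕ) (g : G) :
    convPow (lazyWalk S) n g = (lazyWalkAlg S ^ n).coeff g := by
  induction n generalizing g with
  | zero => simp [convPow, MonoidAlgebra.one_def, Finsupp.single_apply, eq_comm (a := (1 : G))]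
  | succ n ih =>
    rw [pow_succ, MonoidAlgebra.coeff_mul_eq_tsum]
    simp only [convPow, ih, coeff_lazyWalkAlg]

lemma convPow_nonneg {P : G → ℝ} (hP : ∀ g, 0 ≤ P g) (n : ℕ) (g : G) : 0 ≤ convPow P n g := by
  induction n generalizing g with
  | zero => unfold convPow; positivity
  | succ n ih => exact tsum_nonneg fun h => mul_nonneg (ih h) (hP _)

lemma sum_convPow_lazyWalk {S : Finset G} (hS1 : (1 : G) ∉ S) (hSne : S.Nonempty) (n : ℕ) :
    ∑ g ∈ (lazyWalkAlg S ^ n).coeff.support, convPow (lazyWalk S) n g = 1 := by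
  have h (f : MonoidAlgebra ℝ G) :
      MonoidAlgebra.lift ℝ ℝ G 1 f = f.coeff.sum fun _ r => r := by
    simp [MonoidAlgebra.lift_apply]
  have h1 := h (lazyWalkAlg S ^ n)
  rw [map_pow, h, sum_coeff_lazyWalkAlg hS1 hSne, one_pow] at h1
  rw [h1]
  exact Finset.sum_congr rfl fun g _ => convPow_lazyWalk S n g

lemma convPow_lazyWalk_le_exp {S : Finset G}
    (hS1 : (1 : G) ∉ S) (hSne : S.Nonempty) (hsym : ∀ s ∈ S, s⁻¹ ∈ S)
    (hgen : Subgroup.closure (S : Set G) = ⊤) {n : ℕ} (hn : 1 ≤ n) (g : G) :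
    convPow (lazyWalk S) n g ≤
      2 * Real.exp (-((wordLength (S : Set G) g : ℝ) ^ 2 / (2 * n))) := by
  rw [convPow_lazyWalk]
  refine coeff_pow_le_exp (by simpa using hsym) hgen (fun x hx => ?_) (isSymm_lazyWalkAlg hsym)
    (lazyWalk_nonneg S) (sum_coeff_lazyWalkAlg hS1 hSne).le hn g
  refine lazyWalk_eq_zero fun h => ?_
  rcases Finset.mem_insert.1 h with rfl | h
  · simp [wordLength_one] at hx
  · exact absurd (wordLength_le_one (Finset.mem_coe.2 h)) (by omega)

end LazyWalk

lemma summable_mul_exp_neg_rpow {ν : ℝ} (hν : 0 < ν) :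
    Summable fun k : ℕ => (k : ℝ) * Real.exp (-(k : ℝ) ^ ν) := by
  obtain ⟨m, hm⟩ := exists_nat_gt (3 / ν)
  have hm' : 3 ≤ ν * m := by
    rw [div_lt_iff₀ hν] at hm
    linarith
  refine Summable.of_nonneg_of_le (fun k => by positivity) (fun k => ?_)
    ((Real.summable_one_div_nat_pow.2 (by norm_num : 1 < 2)).mul_left (m.factorial : ℝ))
  rcases Nat.eq_zero_or_pos k with rfl | hk
  · simp
  have hk1 : (1 : ℝ) ≤ k := by exact_mod_cast hk
  have h1 : (k : ℝ) ^ 3 ≤ ((k : ℝ) ^ ν) ^ m := by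
    rw [← Real.rpow_mul_natCast (by positivity), ← Real.rpow_natCast]
    exact Real.rpow_le_rpow_of_exponent_le hk1 (by exact_mod_cast hm')
  have h2 := Real.pow_div_factorial_le_exp ((k : ℝ) ^ ν) (by positivity) m
  rw [div_le_iff₀ (by positivity)] at h2
  rw [Real.exp_neg, ← div_eq_mul_inv, mul_one_div, div_le_div_iff₀ (by positivity) (by positivity)]
  calc (k : ℝ) * k ^ 2 = k ^ 3 := by ring
    _ ≤ _ := h1.trans h2
    _ = _ := mul_comm _ _

lemma mul_rpow_le_sq_div {ν A n k : ℝ} (hν : ν ≤ 1) (hA : 0 < A) (hn : 0 < n)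
    (hk : (2 * A * n) ^ (1 / (2 - ν)) < k) : A * k ^ ν ≤ k ^ 2 / (2 * n) := by
  have h2 : 0 < 2 - ν := by linarith
  have hk0 : 0 < k := (Real.rpow_nonneg (by positivity) _).trans_lt hk
  have h : 2 * A * n ≤ k ^ (2 - ν) := by
    have := Real.rpow_le_rpow (Real.rpow_nonneg (by positivity) _) hk.le h2.le
    rwa [← Real.rpow_mul (by positivity), one_div_mul_cancel h2.ne', Real.rpow_one] at this
  rw [le_div_iff₀ (by positivity)]
  calc A * k ^ ν * (2 * n) = 2 * A * n * k ^ ν := by ring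
    _ ≤ k ^ (2 - ν) * k ^ ν := by gcongr
    _ = k ^ 2 := by
      rw [← Real.rpow_add hk0, sub_add_cancel]
      exact Real.rpow_two k

lemma sum_comp_wordLength_le {G : Type*} [Group G] {S : Finset G}
    (hsym : ∀ s ∈ S, s⁻¹ ∈ S) (hgen : Subgroup.closure (S : Set G) = ⊤)
    (F : Finset G) {φ : ℕ → ℝ} (hφ : ∀ k, 0 ≤ φ k)
    (hsum : Summable fun k => (Nat.card (ball (S : Set G) k) : ℝ) * φ k) :
    ∑ g ∈ F, φ (wordLength (S : Set G) g) ≤ ∑' k, (Nat.card (ball (S : Set G) k) : ℝ) * φ k := by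
  rw [Finset.sum_comp φ (wordLength (S : Set G))]
  refine le_trans (Finset.sum_le_sum fun k _ => ?_)
    (hsum.sum_le_tsum (F.image (wordLength (S : Set G)))
      fun k _ => mul_nonneg (Nat.cast_nonneg _) (hφ k))
  rw [nsmul_eq_mul]
  refine mul_le_mul_of_nonneg_right ?_ (hφ k)
  rw [Nat.card_coe_set_eq, Nat.cast_le, ← Set.ncard_coe_finset]
  refine Set.ncard_le_ncard (fun g hg => ?_) (finite_ball hsym hgen k)
  rw [Finset.mem_coe, Finset.mem_filter] at hg
  exact hg.2.le

/-- if `|B_n| ≤ L·exp(K·n^ν)` then the speed satisfies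
`E|P^{(n)}| ≤ K'·n^{1/(2−ν)}`. -/
theorem stmt3 {G : Type*} [Group G] (S : Finset G)
    (hS1 : (1 : G) ∉ S) (hSne : S.Nonempty) (hsym : ∀ s ∈ S, s⁻¹ ∈ S)
    (hgen : Subgroup.closure (S : Set G) = ⊤)
    (K L ν : ℝ) (hK : 0 < K) (hL : 0 < L) (hν0 : 0 < ν) (hν1 : ν ≤ 1)
    (hvol : ∀ n : ℕ, 1 ≤ n →
      (Nat.card ↥(ball (S : Set G) n) : ℝ) ≤ L * Real.exp (K * (n : ℝ) ^ ν)) :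
    ∃ K' : ℝ, 0 < K' ∧ ∀ n : ℕ, 1 ≤ n →
      speed (S : Set G) (lazyWalk S) n ≤ K' * (n : ℝ) ^ (1 / (2 - ν)) := by
  have hK1 : 0 < K + 1 := by linarith
  have h2ν : 0 < 2 - ν := by linarith
  set φ : ℕ → ℝ := fun k => 2 * k * Real.exp (-((K + 1) * (k : ℝ) ^ ν)) with hφdef
  have hφ (k : ℕ) : 0 ≤ φ k := by positivity
  have hsum : Summable fun k => (Nat.card (ball (S : Set G) k) : ℝ) * φ k := by
    refine Summable.of_nonneg_of_le (fun k => mul_nonneg (Nat.cast_nonneg _) (hφ k))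
      (fun k => ?_) ((summable_mul_exp_neg_rpow hν0).mul_left (2 * L))
    rcases Nat.eq_zero_or_pos k with rfl | hk
    · simp [hφdef]
    calc (Nat.card (ball (S : Set G) k) : ℝ) * φ k
        ≤ L * Real.exp (K * (k : ℝ) ^ ν) * φ k := mul_le_mul_of_nonneg_right (hvol k hk) (hφ k)
      _ = 2 * L * (k * (Real.exp (K * (k : ℝ) ^ ν) * Real.exp (-((K + 1) * (k : ℝ) ^ ν)))) := by
        rw [hφdef]; ring
      _ = 2 * L * (k * Real.exp (-(k : ℝ) ^ ν)) := by
        rw [← Real.exp_add]; ring_nf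
  set C := ∑' k, (Nat.card (ball (S : Set G) k) : ℝ) * φ k
  have hC : 0 ≤ C := tsum_nonneg fun k => mul_nonneg (Nat.cast_nonneg _) (hφ k)
  refine ⟨(2 * (K + 1)) ^ (1 / (2 - ν)) + C, by positivity, fun n hn => ?_⟩
  have hn1 : (1 : ℝ) ≤ n := by exact_mod_cast hn
  set R : ℝ := (2 * (K + 1) * n) ^ (1 / (2 - ν)) with hR
  have hpt (g : G) : convPow (lazyWalk S) n g * (wordLength (S : Set G) g : ℝ) ≤
      convPow (lazyWalk S) n g * R + φ (wordLength (S : Set G) g) := by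
    have hnn := convPow_nonneg (lazyWalk_nonneg S) n g
    rcases le_or_gt (wordLength (S : Set G) g : ℝ) R with h | h
    · have := mul_le_mul_of_nonneg_left h hnn
      linarith [hφ (wordLength (S : Set G) g)]
    · have h1 := mul_rpow_le_sq_div hν1 hK1 (by linarith) h
      have h2 := convPow_lazyWalk_le_exp hS1 hSne hsym hgen hn g
      have h3 := Real.exp_le_exp.2 (neg_le_neg h1)
      have hR0 : 0 ≤ R := by positivity
      have h4 : convPow (lazyWalk S) n g * (wordLength (S : Set G) g : ℝ) ≤
          2 * Real.exp (-((K + 1) * (wordLength (S : Set G) g : ℝ) ^ ν)) *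
            (wordLength (S : Set G) g : ℝ) := by
        gcongr
        linarith
      have h5 : 2 * Real.exp (-((K + 1) * (wordLength (S : Set G) g : ℝ) ^ ν)) *
          (wordLength (S : Set G) g : ℝ) = φ (wordLength (S : Set G) g) := by
        rw [hφdef]; ring
      linarith [mul_nonneg hnn hR0]
  have hspeed : speed (S : Set G) (lazyWalk S) n ≤ R + C := by
    rw [speed, tsum_eq_sum (s := (lazyWalkAlg S ^ n).coeff.support) fun g hg => by
      rw [convPow_lazyWalk, Finsupp.notMem_support_iff.1 hg, zero_mul]]
    refine (Finset.sum_le_sum fun g _ => hpt g).trans ?_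
    rw [Finset.sum_add_distrib, ← Finset.sum_mul, sum_convPow_lazyWalk hS1 hSne, one_mul]
    gcongr
    exact sum_comp_wordLength_le hsym hgen _ hφ hsum
  have hpow : 1 ≤ (n : ℝ) ^ (1 / (2 - ν)) := Real.one_le_rpow hn1 (by positivity)
  calc speed (S : Set G) (lazyWalk S) n ≤ R + C := hspeed
    _ ≤ R + C * (n : ℝ) ^ (1 / (2 - ν)) := by gcongr; exact le_mul_of_one_le_right hC hpow
    _ = _ := by rw [hR, Real.mul_rpow (by positivity) (by positivity)]; ring
end

section
/- Let G be a group with a finite symmetric generating set S (e ∉ S) and let P be the lazy simple random walk measure. Let f_P : ℕ → ℝ be a nonnegative, nondecreasing, subadditive function (f_P(n+m) ≤ f_P(n) + f_P(m)) such that P^{(n)}(e) ≥ exp(−f_P(n)) for all n ≥ 1. Then for every n ≥ 1 there exists an integer k with n ≤ k ≤ 2n such that 1 − P^{(2k+1)}(e)/P^{(2k)}(e) ≤ 8·f_P(n)/n. -/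
open scoped Classical

section LazyWalk

variable {G : Type*} [Group G]

theorem convPow_lazyWalk_succ (S : Finset G) (n : ℕ) (g : G) :
    convPow (lazyWalk S) (n + 1) g = (convPow (lazyWalk S) n g +
      (S.card : ℝ)⁻¹ * ∑ s ∈ S, convPow (lazyWalk S) n (g * s⁻¹)) / 2 := by
  have hleft : HasSum (fun h : G => convPow (lazyWalk S) n h *
      (if h⁻¹ * g = 1 then (1 : ℝ) / 2 else 0)) (convPow (lazyWalk S) n g * (1 / 2)) := by
    convert hasSum_single g ?_ using 1
    · simp
    · intro h hh
      rw [if_neg, mul_zero]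
      rwa [inv_mul_eq_one]
  have hright : HasSum (fun h : G => convPow (lazyWalk S) n h *
      (if h⁻¹ * g ∈ S then 1 / (2 * (S.card : ℝ)) else 0))
      (∑ s ∈ S, convPow (lazyWalk S) n (g * s⁻¹) * (1 / (2 * (S.card : ℝ)))) := by
    let e : G ≃ G := (Equiv.inv G).trans (Equiv.mulLeft g)
    rw [← e.hasSum_iff]
    convert hasSum_sum_of_ne_finset_zero (s := S) ?_ using 1
    · refine Finset.sum_congr rfl fun s hs => ?_
      simp [e, hs]
    · intro s hs
      simp [e, hs]
    · infer_instance
  have hsum := (hleft.add hright).tsum_eq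
  simp only [← mul_add] at hsum
  rw [convPow]
  simp only [lazyWalk] at hsum ⊢
  rw [hsum, ← Finset.sum_mul]
  field_simp

theorem support_convPow_lazyWalk_finite (S : Finset G) (n : ℕ) :
    (Function.support (convPow (lazyWalk S) n)).Finite := by
  induction n with
  | zero =>
    refine (Set.finite_singleton (1 : G)).subset fun g hg => ?_
    by_contra hne
    exact hg (if_neg hne)
  | succ n ih =>
    refine (ih.union (S.finite_toSet.biUnion fun s _ =>
      ih.image fun h => h * s)).subset fun g hg => ?_
    by_contra hne
    simp only [Set.mem_union, Set.mem_iUnion, Set.mem_image, Function.mem_support,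
      not_or, not_exists, not_and, not_not] at hne
    refine hg ?_
    rw [convPow_lazyWalk_succ, hne.1, Finset.sum_eq_zero]
    · simp
    · intro s hs
      by_contra hs0
      exact hne.2 s hs (g * s⁻¹) hs0 (by simp)

theorem summable_mul_convPow_lazyWalk (S : Finset G) (n : ℕ) (f : G → ℝ) :
    Summable fun g => f g * convPow (lazyWalk S) n g :=
  summable_of_hasFiniteSupport
    ((support_convPow_lazyWalk_finite S n).subset (Function.support_mul_subset_right _ _))

theorem summable_mul_convPow_lazyWalk_translate (S : Finset G) (n : ℕ) (f : G → ℝ) (t : G) :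
    Summable fun g => f g * convPow (lazyWalk S) n (g * t) := by
  rw [← (Equiv.mulRight t⁻¹).summable_iff]
  simpa [Function.comp_def] using summable_mul_convPow_lazyWalk S n fun g => f (g * t⁻¹)

theorem tsum_mul_convPow_lazyWalk_succ (S : Finset G) (n : ℕ) (f : G → ℝ) :
    ∑' g, f g * convPow (lazyWalk S) (n + 1) g = (∑' g, f g * convPow (lazyWalk S) n g +
      (S.card : ℝ)⁻¹ * ∑ s ∈ S, ∑' g, f g * convPow (lazyWalk S) n (g * s⁻¹)) / 2 := by
  have hs := fun s (_ : s ∈ S) => summable_mul_convPow_lazyWalk_translate S n f s⁻¹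
  rw [← Summable.tsum_finsetSum hs, ← tsum_mul_left, ← Summable.tsum_add
    (summable_mul_convPow_lazyWalk S n f) ((summable_sum hs).mul_left _), ← tsum_div_const]
  refine tsum_congr fun g => ?_
  rw [convPow_lazyWalk_succ, ← Finset.mul_sum]
  ring

/-- Convolution by the lazy walk measure of a symmetric set is a symmetric operator. -/
theorem tsum_convPow_lazyWalk_succ_mul {S : Finset G} (hsym : ∀ s ∈ S, s⁻¹ ∈ S) (m n : ℕ) :
    ∑' g, convPow (lazyWalk S) (m + 1) g * convPow (lazyWalk S) n g =
      ∑' g, convPow (lazyWalk S) m g * convPow (lazyWalk S) (n + 1) g := by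
  rw [tsum_mul_convPow_lazyWalk_succ]
  simp only [mul_comm (convPow (lazyWalk S) (m + 1) _)]
  rw [tsum_mul_convPow_lazyWalk_succ]
  congr 3
  · simp only [mul_comm]
  · refine Finset.sum_bij' (fun s _ => s⁻¹) (fun s _ => s⁻¹) hsym hsym
      (by simp) (by simp) fun s _ => ?_
    rw [← (Equiv.mulRight s).tsum_eq]
    simp [mul_comm]

theorem convPow_lazyWalk_add_one_eq_tsum {S : Finset G} (hsym : ∀ s ∈ S, s⁻¹ ∈ S) (m n : ℕ) :
    convPow (lazyWalk S) (m + n) 1 =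
      ∑' g, convPow (lazyWalk S) m g * convPow (lazyWalk S) n g := by
  induction m generalizing n with
  | zero =>
    rw [tsum_eq_single (1 : G) fun g hg => by simp [convPow, hg]]
    simp [convPow]
  | succ m ih => rw [tsum_convPow_lazyWalk_succ_mul hsym, ← ih, Nat.add_right_comm, Nat.add_assoc]

theorem convPow_lazyWalk_le_one {S : Finset G} (hS : S.Nonempty) (n : ℕ) (g : G) :
    convPow (lazyWalk S) n g ≤ 1 := by
  induction n generalizing g with
  | zero => simp only [convPow]; split_ifs <;> norm_num
  | succ n ih =>
    have hcard : (0 : ℝ) < S.card := by exact_mod_cast hS.card_pos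
    have hsum : ∑ s ∈ S, convPow (lazyWalk S) n (g * s⁻¹) ≤ S.card := by
      simpa using Finset.sum_le_sum fun s (_ : s ∈ S) => ih (g * s⁻¹)
    have hmean : (S.card : ℝ)⁻¹ * ∑ s ∈ S, convPow (lazyWalk S) n (g * s⁻¹) ≤ 1 := by
      rw [inv_mul_le_iff₀ hcard, mul_one]
      exact hsum
    rw [convPow_lazyWalk_succ]
    linarith [ih g]

theorem convPow_lazyWalk_even_le_odd {S : Finset G} (hS : S.Nonempty)
    (hsym : ∀ s ∈ S, s⁻¹ ∈ S) (k : ℕ) :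
    convPow (lazyWalk S) (2 * k + 2) 1 ≤ convPow (lazyWalk S) (2 * k + 1) 1 := by
  have hcard : (0 : ℝ) < S.card := by exact_mod_cast hS.card_pos
  rw [show 2 * k + 2 = (k + 1) + (k + 1) by ring, show 2 * k + 1 = k + (k + 1) by ring,
    convPow_lazyWalk_add_one_eq_tsum hsym, convPow_lazyWalk_add_one_eq_tsum hsym]
  set u := convPow (lazyWalk S) k
  set v := convPow (lazyWalk S) (k + 1)
  have hsq : Summable fun g => u g * u g := summable_mul_convPow_lazyWalk S k u
  have htrans (s : G) : Summable fun g => u (g * s⁻¹) * u (g * s⁻¹) :=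
    (Equiv.mulRight s⁻¹).summable_iff.2 hsq
  have hmean : Summable fun g => (S.card : ℝ)⁻¹ * ∑ s ∈ S, u (g * s⁻¹) * u (g * s⁻¹) :=
    (summable_sum fun s _ => htrans s).mul_left _
  have hmean_eq : ∑' g, (S.card : ℝ)⁻¹ * ∑ s ∈ S, u (g * s⁻¹) * u (g * s⁻¹) =
      ∑' g, u g * u g := by
    rw [tsum_mul_left, Summable.tsum_finsetSum fun s _ => htrans s]
    have htsum (s : G) : ∑' g, u (g * s⁻¹) * u (g * s⁻¹) = ∑' g, u g * u g :=
      (Equiv.mulRight s⁻¹).tsum_eq fun g => u g * u g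
    simp only [htsum]
    rw [Finset.sum_const, nsmul_eq_mul, inv_mul_cancel_left₀ hcard.ne']
  have huv : Summable fun g => u g * v g := summable_mul_convPow_lazyWalk S (k + 1) u
  have hvv : Summable fun g => v g * v g := summable_mul_convPow_lazyWalk S (k + 1) v
  have hpoint (g : G) : u g * u g - (S.card : ℝ)⁻¹ * ∑ s ∈ S, u (g * s⁻¹) * u (g * s⁻¹) ≤
      4 * (u g * v g - v g * v g) := by
    have hvg : v g = (u g + (S.card : ℝ)⁻¹ * ∑ s ∈ S, u (g * s⁻¹)) / 2 :=
      convPow_lazyWalk_succ S k g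
    have hcs := sq_sum_le_card_mul_sum_sq (s := S) (f := fun s => u (g * s⁻¹))
    have hjensen : ((S.card : ℝ)⁻¹ * ∑ s ∈ S, u (g * s⁻¹)) ^ 2 ≤
        (S.card : ℝ)⁻¹ * ∑ s ∈ S, u (g * s⁻¹) * u (g * s⁻¹) := by
      simp only [← pow_two]
      rw [mul_pow, inv_pow, inv_mul_le_iff₀ (by positivity)]
      calc _ ≤ _ := hcs
        _ = _ := by field_simp
    rw [hvg]
    linarith
  have hle := Summable.tsum_le_tsum hpoint (hsq.sub hmean) ((huv.sub hvv).mul_left 4)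
  rw [Summable.tsum_sub hsq hmean, hmean_eq, tsum_mul_left, Summable.tsum_sub huv hvv] at hle
  linarith

end LazyWalk

/-- if `P^{(n)}(e) ≥ exp(−f_P(n))` for a nonnegative nondecreasing
subadditive `f_P`, then for every `n ≥ 1` there is `k ∈ [n,2n]` with
`1 − P^{(2k+1)}(e)/P^{(2k)}(e) ≤ 8 f_P(n)/n`. -/
theorem stmt10 {G : Type*} [Group G] (S : Finset G)
    (hS1 : (1 : G) ∉ S) (hSne : S.Nonempty) (hsym : ∀ s ∈ S, s⁻¹ ∈ S)
    (hgen : Subgroup.closure (S : Set G) = ⊤)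
    (fP : ℕ → ℝ) (hf0 : ∀ n, 0 ≤ fP n) (hmono : Monotone fP)
    (hsub : ∀ n m, fP (n + m) ≤ fP n + fP m)
    (hret : ∀ n : ℕ, 1 ≤ n → Real.exp (-(fP n)) ≤ convPow (lazyWalk S) n 1) :
    ∀ n : ℕ, 1 ≤ n → ∃ k : ℕ, n ≤ k ∧ k ≤ 2 * n ∧
      1 - convPow (lazyWalk S) (2 * k + 1) 1 / convPow (lazyWalk S) (2 * k) 1 ≤
        8 * fP n / (n : ℝ) := by
  intro n hn
  have hn0 : (0 : ℝ) < n := by exact_mod_cast hn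
  by_contra! hcon
  set ε := 8 * fP n / (n : ℝ) with hε
  have hstep (k : ℕ) (hnk : n ≤ k) (hk : k ≤ 2 * n) :
      convPow (lazyWalk S) (2 * (k + 1)) 1 <
        Real.exp (-ε) * convPow (lazyWalk S) (2 * k) 1 := by
    have hpos : 0 < convPow (lazyWalk S) (2 * k) 1 :=
      (Real.exp_pos _).trans_le (hret _ (by omega))
    have hratio := hcon k hnk hk
    calc convPow (lazyWalk S) (2 * (k + 1)) 1
        ≤ convPow (lazyWalk S) (2 * k + 1) 1 := convPow_lazyWalk_even_le_odd hSne hsym k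
      _ < (1 - ε) * convPow (lazyWalk S) (2 * k) 1 := by
          rw [← div_lt_iff₀ hpos]
          linarith
      _ ≤ Real.exp (-ε) * convPow (lazyWalk S) (2 * k) 1 := by
          gcongr
          exact Real.one_sub_le_exp_neg ε
  have hiter (m : ℕ) (hm : m ≤ n) :
      convPow (lazyWalk S) (2 * (n + m)) 1 ≤ Real.exp (-(m * ε)) := by
    induction m with
    | zero => simpa using convPow_lazyWalk_le_one hSne (2 * n) 1
    | succ m ih =>
      calc _ ≤ _ := (hstep (n + m) (by omega) (by omega)).le
        _ ≤ Real.exp (-ε) * Real.exp (-(m * ε)) := by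
          gcongr
          exact ih (by omega)
        _ = _ := by
          rw [← Real.exp_add]
          push_cast
          ring_nf
  have hlt : Real.exp (-fP (2 * (n + n + 1))) < Real.exp (-ε + -(n * ε)) := by
    rw [Real.exp_add]
    calc _ ≤ _ := hret _ (by omega)
      _ < _ := hstep (n + n) (by omega) (by omega)
      _ ≤ _ := by
        gcongr
        exact hiter n le_rfl
  rw [Real.exp_lt_exp] at hlt
  have hnε : n * ε = 8 * fP n := by rw [hε]; field_simp
  have hε0 : 0 ≤ ε := div_nonneg (mul_nonneg (by norm_num) (hf0 n)) hn0.le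
  have htwo : fP (n + n) ≤ 2 * fP n := by linarith [hsub n n]
  have hfour := hsub (n + n) (n + n)
  have hsix := hsub (n + n + (n + n)) (n + n)
  have hle := hmono (show 2 * (n + n + 1) ≤ n + n + (n + n) + (n + n) by omega)
  linarith [hf0 n]
end
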